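/- Let a > 0, let ν be a nonzero real number, let α ∈ ℂ, and define h(z) = e^{αz}·(a/2)·sinh(a(z + ν)/2)/( sinh(az/2)·sinh(aν/2) ), which is meromorphic on ℂ with poles exactly where sinh(az/2) = 0. Then for every β > 0, every integer n ≥ 2 and every 1 ≤ k ≤ n−1, h satisfies the Ruijsenaars functional equation: S_{n,k}(h, β, x) = 0 for all x ∈ ℝⁿ with pairwise distinct coordinates. (This is the hyperbolic degeneration of the Ruijsenaars solution h(x) = b·σ(x+ν)e^{αx}/(σ(x)σ(ν)); note h(z)h(−z) = (a²/4)(1/sinh²(aν/2) − 1/sinh²(az/2)).) -/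

import Mathlib

/-- The Ruijsenaars sum `S_{n,k}(h, β, x)`. -/
noncomputable def ruijSum (h : ℂ → ℂ) (n k : ℕ) (β : ℝ) (x : Fin n → ℝ) : ℂ :=
  ∑ I ∈ Finset.powersetCard k (Finset.univ : Finset (Fin n)),
    ((∏ i ∈ I, ∏ j ∈ Iᶜ, h ((x j : ℂ) - (x i : ℂ)) *
        h ((x i : ℂ) - (x j : ℂ) - Complex.I * (β : ℂ))) -
     (∏ i ∈ I, ∏ j ∈ Iᶜ, h ((x i : ℂ) - (x j : ℂ)) *
        h ((x j : ℂ) - (x i : ℂ) - Complex.I * (β : ℂ))))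

section Identity

open Finset Polynomial

/-- The two-point factor of the Ruijsenaars sum in exponential variables. -/
noncomputable def ruijFactor (p q x y : ℂ) : ℂ :=
  (q * y - x) * (q * p * x - y) / ((y - x) * (p * x - y))

theorem ruijFactor_mul_eq {p q x y d v : ℂ} (hyx : y - x ≠ 0) (hpxy : p * x - y ≠ 0)
    (h : (q * y - x) * (q * p * x - y) * d = v * ((y - x) * (p * x - y))) :
    ruijFactor p q x y * d = v := by
  rw [ruijFactor, div_mul_eq_mul_div, div_eq_iff (mul_ne_zero hyx hpxy), h]

variable {ι : Type*} [DecidableEq ι]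

/-- The product of the two-point factors over all pairs in `I × (s \ I)`. -/
noncomputable def ruijProd (p q : ℂ) (u : ι → ℂ) (s I : Finset ι) : ℂ :=
  ∏ i ∈ I, ∏ j ∈ s \ I, ruijFactor p q (u i) (u j)

theorem ruijProd_insert_insert (p q : ℂ) (u : ι → ℂ) {a : ι} {t I : Finset ι} (ha : a ∉ t)
    (hI : I ⊆ t) :
    ruijProd p q u (insert a t) (insert a I) =
      ruijProd p q u t I * ∏ j ∈ t \ I, ruijFactor p q (u a) (u j) := by
  have haI : a ∉ I := fun h => ha (hI h)
  have h : insert a t \ insert a I = t \ I := by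
    ext x; simp only [mem_sdiff, mem_insert]; grind
  simp only [ruijProd, h, prod_insert haI]
  ring

theorem ruijProd_insert_of_subset (p q : ℂ) (u : ι → ℂ) {a : ι} {t I : Finset ι} (ha : a ∉ t)
    (hI : I ⊆ t) :
    ruijProd p q u (insert a t) I =
      ruijProd p q u t I * ∏ i ∈ I, ruijFactor p q (u i) (u a) := by
  have haI : a ∉ I := fun h => ha (hI h)
  have hat : a ∉ t \ I := fun h => ha (sdiff_subset h)
  simp only [ruijProd, insert_sdiff_of_notMem t haI, prod_insert hat, prod_mul_distrib]
  ring

/-- The numerator of the Ruijsenaars sum over `insert a t`, seen as a function of the variable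
attached to `a`, in terms of the numerators `A`, `B` and the common denominator `D`. -/
noncomputable def ruijNumer {R : Type*} [CommRing R] [Algebra ℂ R] (p q : ℂ) (u : ι → ℂ)
    (c : ℕ → ℂ) (t : Finset ι) (A B D : ι → R) : R :=
  ∑ I ∈ t.powerset, algebraMap ℂ R (ruijProd p q u t I) *
    (algebraMap ℂ R (c (#I + 1)) * ((∏ j ∈ t \ I, A j) * ∏ j ∈ I, D j) +
      algebraMap ℂ R (c #I) * ((∏ j ∈ I, B j) * ∏ j ∈ t \ I, D j))

theorem ruijNumer_eq_mul_sum (p q : ℂ) (u : ι → ℂ) (c : ℕ → ℂ) {a : ι} {t : Finset ι}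
    (ha : a ∉ t) (A B D : ι → ℂ)
    (hA : ∀ j ∈ t, A j = ruijFactor p q (u a) (u j) * D j)
    (hB : ∀ j ∈ t, B j = ruijFactor p q (u j) (u a) * D j) :
    ruijNumer p q u c t A B D =
      (∑ I ∈ (insert a t).powerset, c #I * ruijProd p q u (insert a t) I) * ∏ j ∈ t, D j := by
  rw [sum_powerset_insert ha, ← sum_add_distrib, sum_mul, ruijNumer]
  refine sum_congr rfl fun I hI => ?_
  have hI : I ⊆ t := mem_powerset.1 hI
  have haI : a ∉ I := fun h => ha (hI h)
  rw [ruijProd_insert_insert p q u ha hI, ruijProd_insert_of_subset p q u ha hI,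
    card_insert_of_notMem haI, prod_congr rfl fun j hj => hA j (sdiff_subset hj),
    prod_congr rfl fun j hj => hB j (hI hj), ← prod_sdiff hI (f := D),
    prod_mul_distrib, prod_mul_distrib]
  simp only [Algebra.algebraMap_self, RingHom.id_apply]
  ring

theorem ruijNumer_insert_of_eq_zero (p q : ℂ) (u : ι → ℂ) (c : ℕ → ℂ) {b : ι} {r : Finset ι}
    (hb : b ∉ r) (A B D : ι → ℂ) (hD : D b = 0) :
    ruijNumer p q u c (insert b r) A B D =
      ∑ K ∈ r.powerset, c (#K + 1) * ruijProd p q u r K *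
        (A b * ((∏ j ∈ r \ K, A j) * ∏ j ∈ K, ruijFactor p q (u j) (u b) * D j) +
          B b * ((∏ j ∈ K, B j) * ∏ j ∈ r \ K, ruijFactor p q (u b) (u j) * D j)) := by
  rw [ruijNumer, sum_powerset_insert hb, ← sum_add_distrib]
  refine sum_congr rfl fun K hK => ?_
  have hK : K ⊆ r := mem_powerset.1 hK
  have hbK : b ∉ K := fun h => hb (hK h)
  have hbr : b ∉ r \ K := fun h => hb (sdiff_subset h)
  have h : insert b r \ insert b K = r \ K := by
    ext x; simp only [mem_sdiff, mem_insert]; grind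
  rw [ruijProd_insert_insert p q u hb hK, ruijProd_insert_of_subset p q u hb hK,
    card_insert_of_notMem hbK, h, insert_sdiff_of_notMem r hbK]
  simp only [prod_insert hbK, prod_insert hbr, hD, prod_mul_distrib, Algebra.algebraMap_self,
    RingHom.id_apply]
  ring

theorem eval_ruijNumer (p q : ℂ) (u : ι → ℂ) (c : ℕ → ℂ) (t : Finset ι) (A B D : ι → ℂ[X])
    (x : ℂ) :
    (ruijNumer p q u c t A B D).eval x =
      ruijNumer p q u c t (fun j => (A j).eval x) (fun j => (B j).eval x)
        (fun j => (D j).eval x) := by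
  simp [ruijNumer, eval_finsetSum, eval_prod]

/-- Cubic polynomials given as products of three linear factors. -/
noncomputable def cubic (a b c d e f : ℂ) : ℂ[X] :=
  (C a * X + C b) * (C c * X + C d) * (C e * X + C f)

theorem natDegree_cubic_le (a b c d e f : ℂ) : (cubic a b c d e f).natDegree ≤ 3 := by
  unfold cubic; compute_degree

theorem coeff_cubic (a b c d e f : ℂ) : (cubic a b c d e f).coeff 3 = a * c * e := by
  unfold cubic; compute_degree!

theorem coeff_prod_mul_prod {s t I : Finset ι} (hI : I ⊆ t) (hs : s = t \ I) (F G : ι → ℂ[X])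
    (α β : ℂ) (hF : ∀ j, (F j).natDegree ≤ 3) (hG : ∀ j, (G j).natDegree ≤ 3)
    (hFc : ∀ j, (F j).coeff 3 = α) (hGc : ∀ j, (G j).coeff 3 = β) :
    ((∏ j ∈ s, F j) * ∏ j ∈ I, G j).natDegree ≤ 3 * #t ∧
    ((∏ j ∈ s, F j) * ∏ j ∈ I, G j).coeff (3 * #t) = α ^ #s * β ^ #I := by
  have hc : 3 * #t = #s * 3 + #I * 3 := by
    have := card_sdiff_add_card_eq_card hI
    subst hs; omega
  have h1 : (∏ j ∈ s, F j).natDegree ≤ #s * 3 :=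
    (natDegree_prod_le _ _).trans (sum_le_card_nsmul _ _ _ fun j _ => hF j)
  have h2 : (∏ j ∈ I, G j).natDegree ≤ #I * 3 :=
    (natDegree_prod_le _ _).trans (sum_le_card_nsmul _ _ _ fun j _ => hG j)
  rw [hc]
  refine ⟨natDegree_mul_le_of_le h1 h2, ?_⟩
  rw [coeff_mul_add_eq_of_natDegree_le h1 h2, coeff_prod_of_natDegree_le _ _ _ fun j _ => hF j,
    coeff_prod_of_natDegree_le _ _ _ fun j _ => hG j]
  simp [hFc, hGc]

theorem degree_ruijNumer_lt (p q : ℂ) (u : ι → ℂ) (c : ℕ → ℂ) (t : Finset ι) (A B D : ι → ℂ[X])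
    (hA : ∀ j, (A j).natDegree ≤ 3) (hB : ∀ j, (B j).natDegree ≤ 3)
    (hD : ∀ j, (D j).natDegree ≤ 3) (hAc : ∀ j, (A j).coeff 3 = q * p)
    (hBc : ∀ j, (B j).coeff 3 = q * p) (hDc : ∀ j, (D j).coeff 3 = p)
    (h0 : ∑ I ∈ t.powerset, (c (#I + 1) * q ^ (#t - #I) + c #I * q ^ #I) *
      ruijProd p q u t I = 0) :
    (ruijNumer p q u c t A B D).degree < (3 * #t : ℕ) := by
  rw [degree_lt_iff_coeff_zero]
  intro m hm
  rw [ruijNumer, finsetSum_coeff]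
  have key : ∀ I ∈ t.powerset, (algebraMap ℂ ℂ[X] (ruijProd p q u t I) *
    (algebraMap ℂ ℂ[X] (c (#I + 1)) * ((∏ j ∈ t \ I, A j) * ∏ j ∈ I, D j) +
      algebraMap ℂ ℂ[X] (c #I) * ((∏ j ∈ I, B j) * ∏ j ∈ t \ I, D j))).coeff m =
      if m = 3 * #t then p ^ #t * ((c (#I + 1) * q ^ (#t - #I) + c #I * q ^ #I) *
        ruijProd p q u t I) else 0 := by
    intro I hI
    have hI : I ⊆ t := mem_powerset.1 hI
    obtain ⟨d1, c1⟩ := coeff_prod_mul_prod hI rfl A D _ _ hA hD hAc hDc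
    obtain ⟨d2, c2⟩ := coeff_prod_mul_prod (s := I) (I := t \ I) sdiff_subset
      (Finset.sdiff_sdiff_eq_self hI).symm B D _ _ hB hD hBc hDc
    simp only [algebraMap_eq, coeff_C_mul, coeff_add]
    split_ifs with h
    · rw [h, c1, c2, card_sdiff_of_subset hI]
      have : #t = (#t - #I) + #I := (Nat.sub_add_cancel (card_le_card hI)).symm
      rw [show p ^ #t = p ^ (#t - #I) * p ^ #I by rw [← pow_add, ← this]]
      ring
    · have hlt : 3 * #t < m := lt_of_le_of_ne hm (Ne.symm h)
      rw [coeff_eq_zero_of_natDegree_lt (d1.trans_lt hlt),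
        coeff_eq_zero_of_natDegree_lt (d2.trans_lt hlt)]
      ring
  rw [sum_congr rfl key]
  split_ifs
  · rw [← mul_sum, h0, mul_zero]
  · simp

theorem card_three_images (p : ℂ) (u : ι → ℂ) (hp : p ≠ 0) (hp2 : p ^ 2 ≠ 1) {t : Finset ι}
    (h0 : ∀ i ∈ t, u i ≠ 0)
    (h1 : ∀ i ∈ t, ∀ j ∈ t, i ≠ j → u i ≠ u j)
    (h2 : ∀ i ∈ t, ∀ j ∈ t, i ≠ j → p * u i ≠ u j)
    (h3 : ∀ i ∈ t, ∀ j ∈ t, i ≠ j → p ^ 2 * u i ≠ u j) :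
    #(t.image u ∪ t.image (fun i => p * u i) ∪ t.image (fun i => u i / p)) = 3 * #t := by
  have hinj : ∀ i ∈ t, ∀ j ∈ t, u i = u j → i = j := fun i hi j hj h => by
    by_contra hne; exact h1 i hi j hj hne h
  have hp1 : p ≠ 1 := fun h => hp2 (by simp [h])
  have n2 : ∀ i ∈ t, ∀ j ∈ t, p * u i ≠ u j := fun i hi j hj h => by
    rcases eq_or_ne i j with rfl | hne
    · exact hp1 (mul_right_cancel₀ (h0 i hi) (by rw [h, one_mul]))
    · exact h2 i hi j hj hne h
  have n3 : ∀ i ∈ t, ∀ j ∈ t, p ^ 2 * u i ≠ u j := fun i hi j hj h => by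
    rcases eq_or_ne i j with rfl | hne
    · exact hp2 (mul_right_cancel₀ (h0 i hi) (by rw [h, one_mul]))
    · exact h3 i hi j hj hne h
  rw [card_union_of_disjoint, card_union_of_disjoint, card_image_of_injOn, card_image_of_injOn,
    card_image_of_injOn]
  · ring
  · intro i hi j hj h
    exact hinj i hi j hj (by simpa [hp] using h)
  · intro i hi j hj h
    exact hinj i hi j hj (by simpa [hp] using h)
  · exact fun i hi j hj h => hinj i hi j hj h
  · rw [disjoint_left]
    intro x hx hy
    obtain ⟨i, hi, rfl⟩ := mem_image.1 hx
    obtain ⟨j, hj, h⟩ := mem_image.1 hy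
    exact n2 j hj i hi h
  · rw [disjoint_left]
    intro x hx hy
    obtain ⟨j, hj, h⟩ := mem_image.1 hy
    rcases mem_union.1 hx with hx | hx
    · obtain ⟨i, hi, rfl⟩ := mem_image.1 hx
      exact n2 i hi j hj (by rw [← h]; field_simp)
    · obtain ⟨i, hi, rfl⟩ := mem_image.1 hx
      refine n3 i hi j hj ?_
      have : u j = p * u i * p := by rw [← (div_eq_iff hp).1 h]
      rw [this]; ring

theorem sum_ruijProd_eq_zero_of_generic (p q : ℂ) (u : ι → ℂ) (hp : p ≠ 0) (hp2 : p ^ 2 ≠ 1)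
    (n : ℕ) : ∀ (s : Finset ι), #s = n → (∀ i ∈ s, u i ≠ 0) →
    (∀ i ∈ s, ∀ j ∈ s, i ≠ j → u i ≠ u j) →
    (∀ i ∈ s, ∀ j ∈ s, i ≠ j → p * u i ≠ u j) →
    (∀ i ∈ s, ∀ j ∈ s, i ≠ j → p ^ 2 * u i ≠ u j) →
    ∀ c : ℕ → ℂ, (∀ k l, k + l = n → c k + c l = 0) →
    ∑ I ∈ s.powerset, c #I * ruijProd p q u s I = 0 := by
  induction n using Nat.strong_induction_on with
  | _ n ih =>
  intro s hs h0 h1 h2 h3 c hc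
  rcases s.eq_empty_or_nonempty with rfl | ⟨a, has⟩
  · have : n = 0 := by simpa using hs.symm
    have hc0 := hc 0 0 (by omega)
    have : c 0 = 0 := by linear_combination hc0 / 2
    simp [this]
  obtain ⟨t, hat, rfl⟩ : ∃ t, a ∉ t ∧ s = insert a t :=
    ⟨s.erase a, notMem_erase a s, (insert_erase has).symm⟩
  rw [card_insert_of_notMem hat] at hs
  have ht : t ⊆ insert a t := subset_insert a t
  set A : ι → ℂ[X] := fun j => cubic (-1) (q * u j) (q * p) (-u j) (-1) (p * u j) with hA
  set B : ι → ℂ[X] := fun j => cubic (-q) (u j) (-1) (q * p * u j) p (-u j) with hB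
  set D : ι → ℂ[X] := fun j => cubic (-1) (u j) p (-u j) (-1) (p * u j) with hD
  have hlead : ∑ I ∈ t.powerset, (c (#I + 1) * q ^ (#t - #I) + c #I * q ^ #I) *
      ruijProd p q u t I = 0 := by
    refine ih #t (by omega) t rfl (fun i hi => h0 i (ht hi))
      (fun i hi j hj => h1 i (ht hi) j (ht hj)) (fun i hi j hj => h2 i (ht hi) j (ht hj))
      (fun i hi j hj => h3 i (ht hi) j (ht hj))
      (fun k => c (k + 1) * q ^ (#t - k) + c k * q ^ k) ?_
    intro k l hkl
    have e1 := hc (k + 1) l (by omega)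
    have e2 := hc k (l + 1) (by omega)
    have hk : #t - k = l := by omega
    have hl : #t - l = k := by omega
    simp only [hk, hl]
    linear_combination q ^ l * e1 + q ^ k * e2
  have hdeg : (ruijNumer p q u c t A B D).degree < (3 * #t : ℕ) := by
    refine degree_ruijNumer_lt p q u c t A B D (fun j => natDegree_cubic_le _ _ _ _ _ _)
      (fun j => natDegree_cubic_le _ _ _ _ _ _) (fun j => natDegree_cubic_le _ _ _ _ _ _)
      (fun j => ?_) (fun j => ?_) (fun j => ?_) hlead <;>
    · simp only [hA, hB, hD, coeff_cubic]; ring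
  have hrest : ∀ b r, b ∉ r → t = insert b r →
      ∑ K ∈ r.powerset, c (#K + 1) * ruijProd p q u r K = 0 := by
    rintro b r hb rfl
    rw [card_insert_of_notMem hb] at hs
    have hr : r ⊆ insert a (insert b r) := (subset_insert b r).trans ht
    exact ih #r (by omega) r rfl (fun i hi => h0 i (hr hi))
      (fun i hi j hj => h1 i (hr hi) j (hr hj)) (fun i hi j hj => h2 i (hr hi) j (hr hj))
      (fun i hi j hj => h3 i (hr hi) j (hr hj)) (fun k => c (k + 1))
      fun k l hkl => hc _ _ (by omega)
  have hzero : ruijNumer p q u c t A B D = 0 := by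
    refine eq_zero_of_degree_lt_of_eval_finset_eq_zero
      (t.image u ∪ t.image (fun i => p * u i) ∪ t.image (fun i => u i / p)) ?_ ?_
    · rwa [card_three_images p u hp hp2 (fun i hi => h0 i (ht hi))
        (fun i hi j hj => h1 i (ht hi) j (ht hj)) (fun i hi j hj => h2 i (ht hi) j (ht hj))
        (fun i hi j hj => h3 i (ht hi) j (ht hj))]
    intro x hx
    obtain ⟨b, hbt, hx⟩ : ∃ b ∈ t, x = u b ∨ x = p * u b ∨ x = u b / p := by
      simp only [mem_union, mem_image] at hx
      grind
    obtain ⟨r, hbr, htr⟩ : ∃ r, b ∉ r ∧ t = insert b r :=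
      ⟨t.erase b, notMem_erase b t, (insert_erase hbt).symm⟩
    have hrt : ∀ j ∈ r, j ∈ insert a t := fun j hj => ht (htr ▸ mem_insert_of_mem hj)
    have hne : ∀ j ∈ r, j ≠ b := fun j hj h => hbr (h ▸ hj)
    have g1 : ∀ j ∈ r, u j - u b ≠ 0 := fun j hj =>
      sub_ne_zero.2 (h1 j (hrt j hj) b (ht hbt) (hne j hj))
    have g2 : ∀ j ∈ r, u b - u j ≠ 0 := fun j hj =>
      sub_ne_zero.2 (h1 j (hrt j hj) b (ht hbt) (hne j hj)).symm
    have g3 : ∀ j ∈ r, p * u j - u b ≠ 0 := fun j hj =>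
      sub_ne_zero.2 (h2 j (hrt j hj) b (ht hbt) (hne j hj))
    have g4 : ∀ j ∈ r, p * u b - u j ≠ 0 := fun j hj =>
      sub_ne_zero.2 (h2 b (ht hbt) j (hrt j hj) (hne j hj).symm)
    rw [eval_ruijNumer, htr, ruijNumer_insert_of_eq_zero p q u c hbr]
    swap
    · rcases hx with rfl | rfl | rfl <;> simp [hD, cubic]
      field_simp
      simp
    rcases hx with hx | hx | hx
    · refine sum_eq_zero fun K hK => ?_
      have hK : K ⊆ r := mem_powerset.1 hK
      have e1 : ∀ j ∈ K, ruijFactor p q (u j) (u b) * (D j).eval x = (B j).eval x := by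
        intro j hj
        refine ruijFactor_mul_eq (g2 j (hK hj)) (g3 j (hK hj)) ?_
        simp only [hD, hB, hx, cubic, eval_mul, eval_add, eval_C, eval_X]
        ring
      have e2 : ∀ j ∈ r \ K, ruijFactor p q (u b) (u j) * (D j).eval x = (A j).eval x := by
        intro j hj
        refine ruijFactor_mul_eq (g1 j (sdiff_subset hj)) (g4 j (sdiff_subset hj)) ?_
        simp only [hD, hA, hx, cubic, eval_mul, eval_add, eval_C, eval_X]
        ring
      rw [prod_congr rfl e1, prod_congr rfl e2]
      have : (A b).eval x = -(B b).eval x := by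
        simp only [hA, hB, hx, cubic, eval_mul, eval_add, eval_C, eval_X]
        ring
      rw [this]
      ring
    · have hAb : (A b).eval x = 0 := by
        simp [hA, hx, cubic]
      have e2 : ∀ j ∈ r, ruijFactor p q (u b) (u j) * (D j).eval x = (B j).eval x := by
        intro j hj
        refine ruijFactor_mul_eq (g1 j hj) (g4 j hj) ?_
        simp only [hD, hB, hx, cubic, eval_mul, eval_add, eval_C, eval_X]
        ring
      have : ∀ K ∈ r.powerset, c (#K + 1) * ruijProd p q u r K *
        ((A b).eval x * ((∏ j ∈ r \ K, (A j).eval x) *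
            ∏ j ∈ K, ruijFactor p q (u j) (u b) * (D j).eval x) +
          (B b).eval x * ((∏ j ∈ K, (B j).eval x) *
            ∏ j ∈ r \ K, ruijFactor p q (u b) (u j) * (D j).eval x)) =
        c (#K + 1) * ruijProd p q u r K * ((B b).eval x * ∏ j ∈ r, (B j).eval x) := by
        intro K hK
        rw [hAb, prod_congr rfl fun j hj => e2 j (sdiff_subset hj),
          ← prod_sdiff (mem_powerset.1 hK)]
        ring
      rw [sum_congr rfl this, ← sum_mul, hrest b r hbr htr, zero_mul]
    · have hBb : (B b).eval x = 0 := by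
        simp only [hB, hx, cubic, eval_mul, eval_add, eval_C, eval_X]
        field_simp
        ring
      have e1 : ∀ j ∈ r, ruijFactor p q (u j) (u b) * (D j).eval x = (A j).eval x := by
        intro j hj
        refine ruijFactor_mul_eq (g2 j hj) (g3 j hj) ?_
        simp only [hD, hA, hx, cubic, eval_mul, eval_add, eval_C, eval_X]
        field_simp
        ring
      have : ∀ K ∈ r.powerset, c (#K + 1) * ruijProd p q u r K *
        ((A b).eval x * ((∏ j ∈ r \ K, (A j).eval x) *
            ∏ j ∈ K, ruijFactor p q (u j) (u b) * (D j).eval x) +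
          (B b).eval x * ((∏ j ∈ K, (B j).eval x) *
            ∏ j ∈ r \ K, ruijFactor p q (u b) (u j) * (D j).eval x)) =
        c (#K + 1) * ruijProd p q u r K * ((A b).eval x * ∏ j ∈ r, (A j).eval x) := by
        intro K hK
        rw [hBb, prod_congr rfl fun j hj => e1 j (mem_powerset.1 hK hj),
          ← prod_sdiff (mem_powerset.1 hK)]
        ring
      rw [sum_congr rfl this, ← sum_mul, hrest b r hbr htr, zero_mul]
  have hneq : ∀ j ∈ t, a ≠ j := fun j hj h => hat (h ▸ hj)
  have hai : a ∈ insert a t := mem_insert_self a t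
  have f1 : ∀ j ∈ t, u j - u a ≠ 0 := fun j hj =>
    sub_ne_zero.2 (h1 a hai j (ht hj) (hneq j hj)).symm
  have f2 : ∀ j ∈ t, u a - u j ≠ 0 := fun j hj =>
    sub_ne_zero.2 (h1 a hai j (ht hj) (hneq j hj))
  have f3 : ∀ j ∈ t, p * u a - u j ≠ 0 := fun j hj =>
    sub_ne_zero.2 (h2 a hai j (ht hj) (hneq j hj))
  have f4 : ∀ j ∈ t, p * u j - u a ≠ 0 := fun j hj =>
    sub_ne_zero.2 (h2 j (ht hj) a hai (hneq j hj).symm)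
  have hDv : ∀ j, (D j).eval (u a) = (u j - u a) * (p * u a - u j) * (p * u j - u a) := by
    intro j
    simp only [hD, cubic, eval_mul, eval_add, eval_C, eval_X]
    ring
  have hev := eval_ruijNumer p q u c t A B D (u a)
  rw [hzero, eval_zero, ruijNumer_eq_mul_sum p q u c hat] at hev
  · refine (mul_eq_zero.1 hev.symm).resolve_right (prod_ne_zero_iff.2 fun j hj => ?_)
    rw [hDv]
    exact mul_ne_zero (mul_ne_zero (f1 j hj) (f3 j hj)) (f4 j hj)
  · intro j hj
    refine (ruijFactor_mul_eq (f1 j hj) (f3 j hj) ?_).symm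
    simp only [hDv, hA, cubic, eval_mul, eval_add, eval_C, eval_X]
    ring
  · intro j hj
    refine (ruijFactor_mul_eq (f2 j hj) (f4 j hj) ?_).symm
    simp only [hDv, hB, cubic, eval_mul, eval_add, eval_C, eval_X]
    ring

theorem sum_ruijProd_eq_zero (p q : ℂ) (u : ι → ℂ) (s : Finset ι)
    (h0 : ∀ i ∈ s, u i ≠ 0)
    (h1 : ∀ i ∈ s, ∀ j ∈ s, i ≠ j → u i ≠ u j)
    (h2 : ∀ i ∈ s, ∀ j ∈ s, i ≠ j → p * u i ≠ u j)
    (c : ℕ → ℂ) (hc : ∀ k l, k + l = #s → c k + c l = 0) :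
    ∑ I ∈ s.powerset, c #I * ruijProd p q u s I = 0 := by
  have hne : ∀ z : ℂ, ∀ᶠ w in nhdsWithin p {p}ᶜ, w ≠ z := fun z =>
    nhdsNE_le_cofinite p (Set.finite_singleton z).compl_mem_cofinite
  have hsq : ∀ z : ℂ, ∀ᶠ w in nhdsWithin p {p}ᶜ, w ^ 2 ≠ z := by
    intro z
    obtain ⟨r, rfl⟩ := IsAlgClosed.exists_pow_nat_eq z (n := 2) two_pos
    filter_upwards [hne r, hne (-r)] with w h h'
    rw [Ne, sq_eq_sq_iff_eq_or_eq_neg]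
    tauto
  have hcont : ContinuousAt (fun w => ∑ I ∈ s.powerset, c #I * ruijProd w q u s I) p := by
    refine tendsto_finsetSum _ fun I hI => ?_
    refine Filter.Tendsto.const_mul _ ?_
    refine tendsto_finsetProd _ fun i hi => tendsto_finsetProd _ fun j hj => ?_
    have his : i ∈ s := mem_powerset.1 hI hi
    have hjs := mem_sdiff.1 hj
    have hij : i ≠ j := fun h => hjs.2 (h ▸ hi)
    have hd : (u j - u i) * (p * u i - u j) ≠ 0 :=
      mul_ne_zero (sub_ne_zero.2 (h1 i his j hjs.1 hij).symm)
        (sub_ne_zero.2 (h2 i his j hjs.1 hij))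
    have : ContinuousAt (fun w => ruijFactor w q (u i) (u j)) p := by
      unfold ruijFactor
      exact ContinuousAt.div (by fun_prop) (by fun_prop) hd
    exact this
  have hz : ∀ᶠ w in nhdsWithin p {p}ᶜ,
      ∑ I ∈ s.powerset, c #I * ruijProd w q u s I = 0 := by
    have k2 : ∀ᶠ w in nhdsWithin p {p}ᶜ, ∀ i ∈ s, ∀ j ∈ s, w ≠ u j / u i :=
      (Filter.eventually_all_finset s).2 fun i _ => (Filter.eventually_all_finset s).2 fun j _ => hne _
    have k3 : ∀ᶠ w in nhdsWithin p {p}ᶜ, ∀ i ∈ s, ∀ j ∈ s, w ^ 2 ≠ u j / u i :=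
      (Filter.eventually_all_finset s).2 fun i _ => (Filter.eventually_all_finset s).2 fun j _ => hsq _
    filter_upwards [hne 0, hsq 1, k2, k3] with w w0 w1 w2 w3
    exact sum_ruijProd_eq_zero_of_generic w q u w0 w1 #s s rfl h0 h1
      (fun i hi j hj _ h => w2 i hi j hj (eq_div_of_mul_eq (h0 i hi) h))
      (fun i hi j hj _ h => w3 i hi j hj (eq_div_of_mul_eq (h0 i hi) h)) c hc
  exact tendsto_nhds_unique_of_eventuallyEq (hcont.tendsto.mono_left nhdsWithin_le_nhds)
    tendsto_const_nhds hz

theorem sum_powersetCard_ruijProd_sub_compl [Fintype ι] (p q : ℂ) (u : ι → ℂ)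
    (h0 : ∀ i, u i ≠ 0) (h1 : ∀ i j, i ≠ j → u i ≠ u j) (h2 : ∀ i j, i ≠ j → p * u i ≠ u j)
    {k : ℕ} (hk : k ≤ Fintype.card ι) :
    ∑ I ∈ powersetCard k (univ : Finset ι),
      (ruijProd p q u univ I - ruijProd p q u univ Iᶜ) = 0 := by
  have h := sum_ruijProd_eq_zero p q u univ (fun i _ => h0 i) (fun i _ j _ => h1 i j)
    (fun i _ j _ => h2 i j)
    (fun m => (if m = k then 1 else 0) - if m = Fintype.card ι - k then 1 else 0) (by
      intro m l hml
      rw [card_univ] at hml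
      have e1 : m = Fintype.card ι - k ↔ l = k := by omega
      have e2 : l = Fintype.card ι - k ↔ m = k := by omega
      simp only [e1, e2]
      ring)
  refine Eq.trans ?_ h
  rw [sum_sub_distrib, powersetCard_eq_filter, sum_filter, sum_filter]
  simp only [sub_mul, sum_sub_distrib, ite_mul, one_mul, zero_mul, powerset_univ]
  congr 1
  refine Fintype.sum_bijective compl compl_bijective _ _ fun I => ?_
  have hI := card_le_univ I
  have hIc : #Iᶜ = Fintype.card ι - k ↔ #I = k := by rw [card_compl]; omega
  simp only [hIc]

end Identity

theorem sinh_mul_add_div_sinh (a ν z : ℂ) :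
    Complex.sinh (a * (z + ν) / 2) / Complex.sinh (a * z / 2) =
      Complex.exp (-(a * ν / 2)) *
        ((Complex.exp (a * ν) * Complex.exp (a * z) - 1) / (Complex.exp (a * z) - 1)) := by
  have key : ∀ w : ℂ, Complex.sinh (w / 2) =
      Complex.exp (-(w / 2)) / 2 * (Complex.exp w - 1) := by
    intro w
    have : Complex.exp w = Complex.exp (w / 2) * Complex.exp (w / 2) := by
      rw [← Complex.exp_add]; ring_nf
    rw [Complex.sinh, this, Complex.exp_neg]
    field_simp [Complex.exp_ne_zero]
  rw [key, key, mul_div_mul_comm, ← Complex.exp_add,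
    show a * ν + a * z = a * (z + ν) by ring]
  congr 1
  rw [div_div_div_cancel_right₀ two_ne_zero, ← Complex.exp_sub]
  congr 1
  ring

theorem hyperbolic_mul_hyperbolic (a ν α β x y : ℂ) (h : ℂ → ℂ)
    (hh : h = fun z => Complex.exp (α * z) * (a / 2) * Complex.sinh (a * (z + ν) / 2) /
      (Complex.sinh (a * z / 2) * Complex.sinh (a * ν / 2))) :
    h (y - x) * h (x - y - Complex.I * β) =
      Complex.exp (-(α * (Complex.I * β))) *
        ((a / 2) / Complex.sinh (a * ν / 2) * Complex.exp (-(a * ν / 2))) ^ 2 *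
        ruijFactor (Complex.exp (-(a * (Complex.I * β)))) (Complex.exp (a * ν))
          (Complex.exp (a * x)) (Complex.exp (a * y)) := by
  have hz : ∀ z, h z = Complex.exp (α * z) *
      ((a / 2) / Complex.sinh (a * ν / 2) * Complex.exp (-(a * ν / 2))) *
      ((Complex.exp (a * ν) * Complex.exp (a * z) - 1) / (Complex.exp (a * z) - 1)) := by
    intro z
    have := sinh_mul_add_div_sinh a ν z
    rw [hh]
    calc _ = Complex.exp (α * z) * ((a / 2) / Complex.sinh (a * ν / 2)) *
          (Complex.sinh (a * (z + ν) / 2) / Complex.sinh (a * z / 2)) := by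
          simp only [div_eq_mul_inv, mul_inv]; ring
      _ = _ := by rw [this]; ring
  have e1 : Complex.exp (a * (y - x)) = Complex.exp (a * y) / Complex.exp (a * x) := by
    rw [← Complex.exp_sub]; ring_nf
  have e2 : Complex.exp (a * (x - y - Complex.I * β)) =
      Complex.exp (-(a * (Complex.I * β))) * Complex.exp (a * x) / Complex.exp (a * y) := by
    rw [← Complex.exp_add, ← Complex.exp_sub]; ring_nf
  have e3 : Complex.exp (-(α * (Complex.I * β))) =
      Complex.exp (α * (y - x)) * Complex.exp (α * (x - y - Complex.I * β)) := by
    rw [← Complex.exp_add]; ring_nf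
  rw [hz, hz, e1, e2, e3, ruijFactor]
  generalize Complex.exp (-(a * (Complex.I * β))) = p
  generalize Complex.exp (a * ν) = q
  have hu := Complex.exp_ne_zero (a * x)
  have hv := Complex.exp_ne_zero (a * y)
  generalize Complex.exp (a * x) = u at hu ⊢
  generalize Complex.exp (a * y) = v at hv ⊢
  have f1 : (q * (v / u) - 1) / (v / u - 1) = (q * v - u) / (v - u) := by
    rw [← mul_div_mul_right _ _ hu]; congr 1 <;> field_simp
  have f2 : (q * (p * u / v) - 1) / (p * u / v - 1) = (q * p * u - v) / (p * u - v) := by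
    rw [← mul_div_mul_right _ _ hv]; congr 1 <;> field_simp
  rw [f1, f2, mul_div_mul_comm]
  ring

/-- The hyperbolic degeneration
`h(z) = e^{αz}·(a/2)·sinh(a(z + ν)/2)/(sinh(az/2)·sinh(aν/2))` of the Ruijsenaars
solution satisfies the Ruijsenaars functional equation for every `β > 0`,
`n ≥ 2` and `1 ≤ k ≤ n − 1`. -/
theorem ruijsenaars_eq_hyperbolic (a : ℝ) (ha : 0 < a) (ν : ℝ) (hν : ν ≠ 0)
    (α : ℂ) (β : ℝ) (hβ : 0 < β) (n k : ℕ) (hn : 2 ≤ n) (hk1 : 1 ≤ k)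
    (hk2 : k ≤ n - 1) :
    ∀ x : Fin n → ℝ, Function.Injective x →
      ruijSum (fun z => Complex.exp (α * z) * ((a : ℂ) / 2) *
          Complex.sinh ((a : ℂ) * (z + (ν : ℂ)) / 2) /
          (Complex.sinh ((a : ℂ) * z / 2) * Complex.sinh ((a : ℂ) * (ν : ℂ) / 2)))
        n k β x = 0 := by
  intro x hx
  set h : ℂ → ℂ := fun z => Complex.exp (α * z) * ((a : ℂ) / 2) *
          Complex.sinh ((a : ℂ) * (z + (ν : ℂ)) / 2) /
          (Complex.sinh ((a : ℂ) * z / 2) * Complex.sinh ((a : ℂ) * (ν : ℂ) / 2)) with hh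
  set u : Fin n → ℂ := fun i => Complex.exp (a * x i) with hu
  set p : ℂ := Complex.exp (-(a * (Complex.I * β))) with hp
  set q : ℂ := Complex.exp (a * ν) with hq
  have hnorm : ∀ i, ‖u i‖ = Real.exp (a * x i) := fun i => by
    rw [hu, Complex.norm_exp]; simp
  have hnp : ‖p‖ = 1 := by rw [hp, Complex.norm_exp]; simp
  have hinj : ∀ i j, i ≠ j → ‖u i‖ ≠ ‖u j‖ := fun i j hij he => by
    rw [hnorm, hnorm, Real.exp_eq_exp] at he
    exact hij (hx (mul_left_cancel₀ ha.ne' he))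
  have key := sum_powersetCard_ruijProd_sub_compl p q u (fun i => Complex.exp_ne_zero _)
    (fun i j hij he => hinj i j hij (by rw [he]))
    (fun i j hij he => hinj i j hij (by rw [← he, norm_mul, hnp, one_mul]))
    (k := k) (by rw [Fintype.card_fin]; omega)
  obtain ⟨γ, hγ⟩ : ∃ γ : ℂ, ∀ i j : Fin n, h ((x j : ℂ) - x i) *
      h ((x i : ℂ) - x j - Complex.I * β) = γ * ruijFactor p q (u i) (u j) :=
    ⟨_, fun i j => hyperbolic_mul_hyperbolic a ν α β (x i) (x j) h hh⟩
  have hterm : ∀ I ∈ Finset.powersetCard k (Finset.univ : Finset (Fin n)),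
      ((∏ i ∈ I, ∏ j ∈ Iᶜ, h ((x j : ℂ) - (x i : ℂ)) *
        h ((x i : ℂ) - (x j : ℂ) - Complex.I * (β : ℂ))) -
       (∏ i ∈ I, ∏ j ∈ Iᶜ, h ((x i : ℂ) - (x j : ℂ)) *
        h ((x j : ℂ) - (x i : ℂ) - Complex.I * (β : ℂ)))) =
      (γ ^ (n - k)) ^ k *
        (ruijProd p q u Finset.univ I - ruijProd p q u Finset.univ Iᶜ) := by
    intro I hI
    have hI : I.card = k := (Finset.mem_powersetCard.1 hI).2
    have hIc : Iᶜ.card = n - k := by rw [Finset.card_compl, hI, Fintype.card_fin]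
    have h2 : ruijProd p q u Finset.univ Iᶜ =
        ∏ i ∈ I, ∏ j ∈ Iᶜ, ruijFactor p q (u j) (u i) := by
      rw [ruijProd, ← Finset.compl_eq_univ_sdiff, compl_compl, Finset.prod_comm]
    rw [h2, ruijProd, ← Finset.compl_eq_univ_sdiff]
    simp only [hγ, Finset.prod_mul_distrib, Finset.prod_const, hI, hIc]
    ring
  rw [ruijSum, Finset.sum_congr rfl hterm, ← Finset.mul_sum, key, mul_zero]
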